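/- Let X be a simplicial complex, q ≥ 2, and X_1, X_2 subcomplexes whose (q−1)-simplices and q-simplices each cover those of X, with no (q−1)-simplex of X_1 being (q−1)-connected to a (q−1)-simplex of X_2. If z is a (q−1)-cycle of X over Z/2, then z ∩ X_1 and z ∩ X_2 are (q−1)-cycles (i.e., their boundaries vanish). -/

import Mathlib

open scoped Classical

/-- An abstract simplicial complex on the vertex set `V`: a set of finite
simplices closed under taking subsets. -/
def IsComplex {V : Type*} (X : Set (Finset V)) : Prop :=
  ∀ s ∈ X, ∀ t : Finset V, t ⊆ s → t ∈ X

/-- The `q`-simplices of `X` (of cardinality `q + 1`). -/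
def simplices {V : Type*} (X : Set (Finset V)) (q : ℕ) : Set (Finset V) :=
  {s | s ∈ X ∧ s.card = q + 1}

/-- The `ZMod 2` simplicial boundary operator on chains (functions from finite
vertex sets to `ZMod 2`): the coefficient of `τ` in `∂c` is the sum of the
coefficients of the sets `τ ∪ {x}`, `x ∉ τ`. -/
noncomputable def sBdry (V : Type*) [Fintype V] [DecidableEq V] :
    (Finset V → ZMod 2) →ₗ[ZMod 2] (Finset V → ZMod 2) :=
  LinearMap.pi fun τ => ∑ x ∈ τᶜ, LinearMap.proj (insert x τ)

/-- Chains supported on a set `S` of simplices. -/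
def sOn {V : Type*} (S : Set (Finset V)) : Submodule (ZMod 2) (Finset V → ZMod 2) :=
  ⨅ s ∈ Sᶜ, LinearMap.ker (LinearMap.proj (R := ZMod 2) (φ := fun _ : Finset V => ZMod 2) s)

/-- The `q`-chains of `X` over `ZMod 2`. -/
def sChains {V : Type*} (X : Set (Finset V)) (q : ℕ) :
    Submodule (ZMod 2) (Finset V → ZMod 2) :=
  sOn (simplices X q)

/-- The `q`-cycles of `X` over `ZMod 2`. -/
noncomputable def sCycles {V : Type*} [Fintype V] [DecidableEq V]
    (X : Set (Finset V)) (q : ℕ) : Submodule (ZMod 2) (Finset V → ZMod 2) :=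
  sChains X q ⊓ LinearMap.ker (sBdry V)

/-- The `q`-boundaries of `X` over `ZMod 2`: boundaries of `(q+1)`-chains. -/
noncomputable def sBdries {V : Type*} [Fintype V] [DecidableEq V]
    (X : Set (Finset V)) (q : ℕ) : Submodule (ZMod 2) (Finset V → ZMod 2) :=
  Submodule.map (sBdry V) (sChains X (q + 1))

/-- The `q`-th simplicial homology of `X` over `ZMod 2`. -/
abbrev sH {V : Type*} [Fintype V] [DecidableEq V] (X : Set (Finset V)) (q : ℕ) :=
  ↥(sCycles X q) ⧸ ((sBdries X q).comap (sCycles X q).subtype)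

/-- Two `q`-simplices (cardinality `q + 1`) share a `(q-1)`-face (of
cardinality `q`). -/
def ShareFace {V : Type*} (q : ℕ) (a b : Finset V) : Prop :=
  a.card = q + 1 ∧ b.card = q + 1 ∧ ∃ t : Finset V, t.card = q ∧ t ⊆ a ∧ t ⊆ b

/-- `q`-connectivity of `q`-simplices in `X`: the reflexive-transitive closure
of sharing a `(q-1)`-face within `X`. -/
def QConn {V : Type*} (X : Set (Finset V)) (q : ℕ) (a b : Finset V) : Prop :=
  Relation.ReflTransGen (fun x y => x ∈ X ∧ y ∈ X ∧ ShareFace q x y) a b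

theorem mem_sOn {V : Type*} {S : Set (Finset V)} {c : Finset V → ZMod 2} :
    c ∈ sOn S ↔ ∀ s, s ∉ S → c s = 0 := by
  simp [sOn, Submodule.mem_iInf]

theorem sBdry_apply {V : Type*} [Fintype V] [DecidableEq V] (c : Finset V → ZMod 2)
    (τ : Finset V) : sBdry V c τ = ∑ x ∈ τᶜ, c (insert x τ) := by
  simp [sBdry]

/-- Restricting a cycle of `X` to a set `Y` of simplices which is closed under passing to
adjacent top-dimensional simplices of `X` gives a cycle of `Y`. -/
theorem restrict_mem_sCycles {V : Type*} [Fintype V] [DecidableEq V]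
    {X Y : Set (Finset V)} {p : ℕ}
    (hclosed : ∀ a ∈ simplices Y p, ∀ b ∈ simplices X p, ShareFace p a b → b ∈ Y)
    {z : Finset V → ZMod 2} (hz : z ∈ sCycles X p) :
    (fun s => if s ∈ Y then z s else 0) ∈ sCycles Y p := by
  obtain ⟨hsupp, hker⟩ := hz
  have hsupp' : ∀ s, s ∉ simplices X p → z s = 0 := mem_sOn.1 hsupp
  refine ⟨mem_sOn.2 fun s hs => ?_, LinearMap.mem_ker.2 (funext fun τ => ?_)⟩
  · by_cases hsY : s ∈ Y
    · simp only [hsY, if_true]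
      exact hsupp' s fun h => hs ⟨hsY, h.2⟩
    · simp [hsY]
  · have hτ : ∑ x ∈ τᶜ, z (insert x τ) = 0 := by
      rw [← sBdry_apply, LinearMap.mem_ker.1 hker, Pi.zero_apply]
    rw [sBdry_apply, Pi.zero_apply]
    by_cases h : ∃ x ∈ τᶜ, insert x τ ∈ simplices Y p
    · obtain ⟨x, hx, hxY⟩ := h
      refine (Finset.sum_congr rfl fun y _ => ?_).trans hτ
      by_cases hyX : insert y τ ∈ simplices X p
      · have hcard : τ.card = p := by
          have := hxY.2
          rw [Finset.card_insert_of_notMem (Finset.mem_compl.1 hx)] at this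
          omega
        exact if_pos (hclosed _ hxY _ hyX ⟨hxY.2, hyX.2, τ, hcard,
          Finset.subset_insert _ _, Finset.subset_insert _ _⟩)
      · simp [hsupp' _ hyX]
    · refine Finset.sum_eq_zero fun y hy => ?_
      by_cases hyY : insert y τ ∈ Y
      · simp only [hyY, if_true]
        exact hsupp' _ fun hyX => h ⟨y, hy, hyY, hyX.2⟩
      · simp [hyY]

/-- with `X₁`, `X₂` subcomplexes of `X` covering its `(q-1)`- and
`q`-simplices and with no `(q-1)`-simplex of `X₁` being `(q-1)`-connected in `X`
to one of `X₂`, the restriction of any `(q-1)`-cycle `z` of `X` to `X₁` (resp.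
`X₂`) is a `(q-1)`-cycle of `X₁` (resp. `X₂`). -/
theorem stmt_9 {V : Type*} [Fintype V] [DecidableEq V]
    (X X₁ X₂ : Set (Finset V)) (q : ℕ) (hq : 2 ≤ q)
    (hX : IsComplex X) (hX₁ : IsComplex X₁) (hX₂ : IsComplex X₂)
    (hs₁ : X₁ ⊆ X) (hs₂ : X₂ ⊆ X)
    (hcov₁ : simplices X (q - 1) = simplices X₁ (q - 1) ∪ simplices X₂ (q - 1))
    (hcov₂ : simplices X q = simplices X₁ q ∪ simplices X₂ q)
    (hsep : ∀ a ∈ simplices X₁ (q - 1), ∀ b ∈ simplices X₂ (q - 1),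
      ¬ QConn X (q - 1) a b)
    (z : Finset V → ZMod 2) (hz : z ∈ sCycles X (q - 1)) :
    (fun s => if s ∈ X₁ then z s else 0) ∈ sCycles X₁ (q - 1) ∧
    (fun s => if s ∈ X₂ then z s else 0) ∈ sCycles X₂ (q - 1) := by
  have hcov : ∀ b ∈ simplices X (q - 1), b ∈ simplices X₁ (q - 1) ∨ b ∈ simplices X₂ (q - 1) :=
    fun b hb => by rwa [hcov₁] at hb
  constructor
  · refine restrict_mem_sCycles (fun a ha b hb hab => ?_) hz
    exact (hcov b hb).elim (fun h => h.1) fun h =>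
      (hsep a ha b h (Relation.ReflTransGen.single ⟨hs₁ ha.1, hb.1, hab⟩)).elim
  · refine restrict_mem_sCycles (fun a ha b hb hab => ?_) hz
    obtain ⟨hca, hcb, t, ht, hta, htb⟩ := hab
    exact (hcov b hb).elim (fun h => (hsep b h a ha (Relation.ReflTransGen.single
      ⟨hb.1, hs₂ ha.1, hcb, hca, t, ht, htb, hta⟩)).elim) fun h => h.1
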